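/- Assume the standard setup with r < t, G not isomorphic to the star K_{1,e}, and e + s ≥ c_r, where s ≥ 1. Let r + 1 ≤ i ≤ t (so Vᵢ is a singleton consisting of a pendant vertex). If c_{j−1} ≤ e < c_j for some 2 ≤ j ≤ r and b = j − 1, then χ_la(G(Vᵢ,s)) = s + t − r + j − 1. -/

import Mathlib

open Finset
open scoped Classical

namespace LocalAntimagic

variable {V : Type*}

/-- The induced vertex label: sum of the labels of edges incident to `v`. -/
noncomputable def vertexSum [Fintype V] (G : SimpleGraph V) (f : Sym2 V → ℕ) (v : V) : ℕ :=
  ∑ e ∈ G.incidenceFinset v, f e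

/-- `f` is a local antimagic labeling of `G`: a bijection from the edge set onto
`{1, …, |E|}` whose induced vertex labels distinguish adjacent vertices. -/
def IsLocalAntimagic [Fintype V] (G : SimpleGraph V) (f : Sym2 V → ℕ) : Prop :=
  Set.BijOn f G.edgeSet (Set.Icc 1 G.edgeFinset.card) ∧
  ∀ ⦃u v : V⦄, G.Adj u v → vertexSum G f u ≠ vertexSum G f v

/-- The color number `c(f)`: the number of distinct induced vertex labels. -/
noncomputable def colorCount [Fintype V] (G : SimpleGraph V) (f : Sym2 V → ℕ) : ℕ :=
  (Finset.univ.image (vertexSum G f)).card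

/-- The local antimagic chromatic number. -/
noncomputable def chiLA [Fintype V] (G : SimpleGraph V) : ℕ :=
  sInf {n | ∃ f, IsLocalAntimagic G f ∧ colorCount G f = n}

/-- A pendant vertex is a vertex of degree 1. -/
def IsPendant [Fintype V] (G : SimpleGraph V) (v : V) : Prop :=
  G.degree v = 1

/-- The number of pendant vertices of `G`. -/
noncomputable def pendantCount [Fintype V] (G : SimpleGraph V) : ℕ :=
  (Finset.univ.filter (fun v => IsPendant G v)).card

/-- `G(S, s)`: the graph obtained from `G` by attaching `s` new pendant edges to every
vertex of `S`.  The new pendant vertex attached to `w ∈ S` via the `j`-th new edge is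
`Sum.inr (w, j)`; the original graph lives on the `Sum.inl` vertices. -/
def attachPendants (G : SimpleGraph V) (S : Finset V) (s : ℕ) :
    SimpleGraph (V ⊕ (S × Fin s)) :=
  SimpleGraph.fromRel (fun a b =>
    (∃ u v : V, a = Sum.inl u ∧ b = Sum.inl v ∧ G.Adj u v) ∨
    (∃ (w : S) (j : Fin s), a = Sum.inl (w : V) ∧ b = Sum.inr (w, j)))

/-- The standard setup: `G` is a connected graph with at least `2` edges and
`χ_la(G) = t ≥ 2`; `f` is a local antimagic labeling of `G` with `c(f) = t` whose color
classes are `Vset 1, …, Vset t` (each nonempty, with `f⁺ ≡ c i` on `Vset i`, and the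
colors `c 1, …, c t` pairwise distinct); every non-pendant vertex lies in
`Vset 1 ∪ ⋯ ∪ Vset r` where `1 ≤ r ≤ t`; each `Vset i` with `r + 1 ≤ i ≤ t` is a
singleton consisting of a pendant vertex; `c 1 < c 2 < ⋯ < c r` and
`c (r+1) < c (r+2) < ⋯ < c t`. -/
structure StandardSetup [Fintype V] (G : SimpleGraph V) (f : Sym2 V → ℕ)
    (t r : ℕ) (Vset : ℕ → Finset V) (c : ℕ → ℕ) : Prop where
  connected : G.Connected
  two_le_card_edges : 2 ≤ G.edgeFinset.card
  chiLA_eq : chiLA G = t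
  two_le_t : 2 ≤ t
  antimagic : IsLocalAntimagic G f
  colorCount_eq : colorCount G f = t
  color_on_class : ∀ i ∈ Finset.Icc 1 t, ∀ v ∈ Vset i, vertexSum G f v = c i
  class_cover : ∀ v : V, ∃ i ∈ Finset.Icc 1 t, v ∈ Vset i
  class_nonempty : ∀ i ∈ Finset.Icc 1 t, (Vset i).Nonempty
  color_injective : ∀ i ∈ Finset.Icc 1 t, ∀ j ∈ Finset.Icc 1 t, i ≠ j → c i ≠ c j
  one_le_r : 1 ≤ r
  r_le_t : r ≤ t
  nonpendant_mem : ∀ v : V, ¬ IsPendant G v → ∃ i ∈ Finset.Icc 1 r, v ∈ Vset i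
  pendant_singleton : ∀ i ∈ Finset.Icc (r + 1) t, ∃ v : V, IsPendant G v ∧ Vset i = {v}
  c_strictMono_low : ∀ i j : ℕ, 1 ≤ i → i < j → j ≤ r → c i < c j
  c_strictMono_high : ∀ i j : ℕ, r + 1 ≤ i → i < j → j ≤ t → c i < c j

/-- `b`: the number of pendant vertices of `G` lying in `Vset 1 ∪ ⋯ ∪ Vset r`. -/
noncomputable def pendantsInLow [Fintype V] (G : SimpleGraph V)
    (Vset : ℕ → Finset V) (r : ℕ) : ℕ :=
  (((Finset.Icc 1 r).biUnion Vset).filter (fun v => IsPendant G v)).card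

section General

variable [Fintype V] {G : SimpleGraph V}

theorem isPendant_iff {v : V} : IsPendant G v ↔ ∃! w, G.Adj v w :=
  SimpleGraph.degree_eq_one_iff_existsUnique_adj

theorem vertexSum_eq_sum_ite (G : SimpleGraph V) (f : Sym2 V → ℕ) (v : V) :
    vertexSum G f v = ∑ w, if G.Adj v w then f s(v, w) else 0 := by
  rw [vertexSum, ← Finset.sum_filter]
  symm
  refine Finset.sum_nbij (fun w => s(v, w)) ?_ ?_ ?_ fun _ _ => rfl
  · intro w hw
    simpa [SimpleGraph.mem_incidenceSet] using hw
  · intro a _ b _ hab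
    exact Sym2.congr_right.mp hab
  · intro x hx
    rw [Finset.mem_coe, SimpleGraph.mem_incidenceFinset] at hx
    obtain ⟨w, rfl⟩ := Sym2.mem_iff_exists.mp hx.2
    exact ⟨w, by simpa using hx.1, rfl⟩

theorem vertexSum_eq_of_adj_unique (f : Sym2 V → ℕ) {v w : V} (h : G.Adj v w)
    (hw : ∀ x, G.Adj v x → x = w) : vertexSum G f v = f s(v, w) := by
  rw [vertexSum_eq_sum_ite, Finset.sum_eq_single w]
  · simp [h]
  · intro x _ hx
    exact if_neg fun hv => hx (hw x hv)
  · simp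

theorem label_le_vertexSum (f : Sym2 V → ℕ) {v w : V} (h : G.Adj v w) :
    f s(v, w) ≤ vertexSum G f v := by
  rw [vertexSum_eq_sum_ite]
  have := Finset.single_le_sum (f := fun x => if G.Adj v x then f s(v, x) else 0)
    (fun _ _ => Nat.zero_le _) (Finset.mem_univ w)
  simpa [h] using this

theorem label_add_label_le_vertexSum (f : Sym2 V → ℕ) {v w x : V} (hw : G.Adj v w)
    (hx : G.Adj v x) (hwx : w ≠ x) : f s(v, w) + f s(v, x) ≤ vertexSum G f v := by
  rw [vertexSum_eq_sum_ite]
  have := Finset.sum_le_sum_of_subset (f := fun y => if G.Adj v y then f s(v, y) else 0)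
    (Finset.subset_univ {w, x})
  simpa [Finset.sum_pair hwx, hw, hx] using this

theorem IsLocalAntimagic.label_mem {f : Sym2 V → ℕ} (hf : IsLocalAntimagic G f) {u v : V}
    (h : G.Adj u v) : 1 ≤ f s(u, v) ∧ f s(u, v) ≤ G.edgeFinset.card :=
  hf.1.mapsTo (G.mem_edgeSet.mpr h)

theorem IsLocalAntimagic.vertexSum_le_of_isPendant {f : Sym2 V → ℕ} (hf : IsLocalAntimagic G f)
    {v : V} (hv : IsPendant G v) : vertexSum G f v ≤ G.edgeFinset.card := by
  obtain ⟨w, hw, hu⟩ := isPendant_iff.mp hv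
  rw [vertexSum_eq_of_adj_unique f hw hu]
  exact (hf.label_mem hw).2

/-- Pendant vertices get distinct colors, none of which is the color of a non-pendant endpoint
of the edge with the largest label. -/
theorem pendantCount_add_one_le_colorCount {f : Sym2 V → ℕ} (hf : IsLocalAntimagic G f)
    (hG : ∀ u v, G.Adj u v → IsPendant G u → ¬ IsPendant G v) (hpos : 1 ≤ G.edgeFinset.card) :
    pendantCount G + 1 ≤ colorCount G f := by
  set P := Finset.univ.filter fun v => IsPendant G v with hP
  have hinj : Set.InjOn (vertexSum G f) P := by
    intro u hu w hw huw
    simp only [hP, Finset.coe_filter, Finset.mem_univ, true_and, Set.mem_ofPred_eq] at hu hw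
    obtain ⟨u', hu', huu⟩ := isPendant_iff.mp hu
    obtain ⟨w', hw', hww⟩ := isPendant_iff.mp hw
    rw [vertexSum_eq_of_adj_unique f hu' huu, vertexSum_eq_of_adj_unique f hw' hww] at huw
    have := hf.1.injOn (G.mem_edgeSet.mpr hu') (G.mem_edgeSet.mpr hw') huw
    rcases Sym2.eq_iff.mp this with h | h
    · exact h.1
    · exact absurd hw (hG u w (h.2 ▸ hu') hu)
  obtain ⟨x, hx⟩ : ∃ x, G.edgeFinset.card < vertexSum G f x := by
    obtain ⟨a, ha, hfa⟩ := hf.1.surjOn (Set.right_mem_Icc.mpr hpos)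
    have key : ∀ u v, G.Adj u v → f s(u, v) = G.edgeFinset.card → ¬ IsPendant G u →
        G.edgeFinset.card < vertexSum G f u := by
      intro u v huv hl hu
      obtain ⟨w, hw, hne⟩ : ∃ w, G.Adj u w ∧ w ≠ v := by
        by_contra! hcon
        exact hu (isPendant_iff.mpr ⟨v, huv, hcon⟩)
      have h1 := label_add_label_le_vertexSum f huv hw hne.symm
      have h2 := (hf.label_mem hw).1
      omega
    induction a with
    | h u v =>
      by_cases hu : IsPendant G u
      · exact ⟨v, key v u ha.symm (Sym2.eq_swap ▸ hfa) (hG u v ha hu)⟩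
      · exact ⟨u, key u v ha hfa hu⟩
  have hnot : vertexSum G f x ∉ P.image (vertexSum G f) := by
    intro hmem
    obtain ⟨p, hp, hpx⟩ := Finset.mem_image.mp hmem
    have := hf.vertexSum_le_of_isPendant (Finset.mem_filter.mp hp).2
    omega
  rw [pendantCount, colorCount, ← Finset.card_image_of_injOn hinj,
    ← Finset.card_insert_of_notMem hnot]
  refine Finset.card_le_card (Finset.insert_subset ?_ ?_)
  · exact Finset.mem_image_of_mem _ (Finset.mem_univ x)
  · exact Finset.image_subset_image (Finset.subset_univ P)

theorem not_isPendant_of_adj_of_isPendant (hG : G.Connected) (hcard : 2 ≤ G.edgeFinset.card)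
    {u v : V} (huv : G.Adj u v) (hu : IsPendant G u) : ¬ IsPendant G v := by
  intro hv
  have hu' : ∀ x, G.Adj u x → v = x := fun _ => (isPendant_iff.mp hu).unique huv
  have hv' : ∀ x, G.Adj v x → u = x := fun _ => (isPendant_iff.mp hv).unique huv.symm
  have hall : ∀ w, w = u ∨ w = v := by
    intro w
    have hr := (SimpleGraph.reachable_iff_reflTransGen u w).mp (hG.preconnected u w)
    induction hr with
    | refl => exact Or.inl rfl
    | tail _ hab ih =>
      rcases ih with rfl | rfl
      · exact Or.inr (hu' _ hab).symm
      · exact Or.inl (hv' _ hab).symm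
  have hsub : G.edgeFinset ⊆ {s(u, v)} := by
    intro a ha
    rw [SimpleGraph.mem_edgeFinset] at ha
    induction a with
    | h x y =>
      have hne : x ≠ y := G.ne_of_adj ha
      rcases hall x with rfl | rfl <;> rcases hall y with rfl | rfl <;> simp_all [Sym2.eq_swap]
  have := Finset.card_le_card hsub
  simp at this
  omega

end General

section AttachPendants

variable {G : SimpleGraph V} {S : Finset V} {s : ℕ}

@[simp]
theorem attachPendants_adj_inl_inl {u v : V} :
    (attachPendants G S s).Adj (Sum.inl u) (Sum.inl v) ↔ G.Adj u v := by
  simp only [attachPendants, SimpleGraph.fromRel_adj]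
  constructor
  · rintro ⟨_, (⟨_, _, h, h', hG⟩ | ⟨_, _, _, h⟩) | (⟨_, _, h, h', hG⟩ | ⟨_, _, _, h⟩)⟩
    · cases h; cases h'; exact hG
    · cases h
    · cases h; cases h'; exact hG.symm
    · cases h
  · exact fun h => ⟨fun h' => h.ne (Sum.inl.inj h'), Or.inl (Or.inl ⟨u, v, rfl, rfl, h⟩)⟩

@[simp]
theorem attachPendants_adj_inl_inr {u : V} {p : S × Fin s} :
    (attachPendants G S s).Adj (Sum.inl u) (Sum.inr p) ↔ u = p.1 := by
  simp only [attachPendants, SimpleGraph.fromRel_adj]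
  constructor
  · rintro ⟨_, (⟨_, _, _, h, _⟩ | ⟨_, _, h, h'⟩) | (⟨_, _, h, _⟩ | ⟨_, _, h, _⟩)⟩
    · cases h
    · cases h; cases h'; rfl
    · cases h
    · cases h
  · rintro rfl
    exact ⟨by simp, Or.inl (Or.inr ⟨p.1, p.2, rfl, rfl⟩)⟩

@[simp]
theorem attachPendants_adj_inr_inl {u : V} {p : S × Fin s} :
    (attachPendants G S s).Adj (Sum.inr p) (Sum.inl u) ↔ u = p.1 := by
  rw [SimpleGraph.adj_comm, attachPendants_adj_inl_inr]

@[simp]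
theorem not_attachPendants_adj_inr_inr {p q : S × Fin s} :
    ¬ (attachPendants G S s).Adj (Sum.inr p) (Sum.inr q) := by
  simp [attachPendants]

section Pendants

variable [Fintype V]

theorem isPendant_attachPendants_inr (p : S × Fin s) :
    IsPendant (attachPendants G S s) (Sum.inr p) := by
  refine isPendant_iff.mpr ⟨Sum.inl p.1, by simp, ?_⟩
  rintro (u | q) h <;> simp_all

theorem isPendant_attachPendants_inl {u : V} (hu : u ∉ S) :
    IsPendant (attachPendants G S s) (Sum.inl u) ↔ IsPendant G u := by
  have hp : ∀ p : S × Fin s, u ≠ p.1 := fun p h => hu (h ▸ p.1.2)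
  simp only [isPendant_iff]
  constructor
  · rintro ⟨w | p, hw, huniq⟩
    · exact ⟨w, by simpa using hw, fun y hy =>
        Sum.inl.inj (huniq (Sum.inl y) (attachPendants_adj_inl_inl.mpr hy))⟩
    · exact absurd (attachPendants_adj_inl_inr.mp hw) (hp p)
  · rintro ⟨w, hw, huniq⟩
    refine ⟨Sum.inl w, by simpa using hw, ?_⟩
    rintro (y | p) hy
    · rw [huniq y (attachPendants_adj_inl_inl.mp hy)]
    · exact absurd (attachPendants_adj_inl_inr.mp hy) (hp p)

theorem not_isPendant_attachPendants_inl {u w : V} (hu : u ∈ S) (h : G.Adj u w) (hs : 1 ≤ s) :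
    ¬ IsPendant (attachPendants G S s) (Sum.inl u) := by
  intro hpend
  have := (isPendant_iff.mp hpend).unique (y₁ := Sum.inl w)
    (y₂ := Sum.inr (⟨u, hu⟩, ⟨0, hs⟩)) (by simpa using h) (by simp)
  simp at this

/-- Attaching pendant edges to non-isolated vertices creates no edge joining two pendant
vertices. -/
theorem not_isPendant_of_attachPendants_adj
    (hG : ∀ u v, G.Adj u v → IsPendant G u → ¬ IsPendant G v)
    (hS : ∀ u ∈ S, ∃ w, G.Adj u w) (hs : 1 ≤ s) (a b : V ⊕ (S × Fin s))
    (hab : (attachPendants G S s).Adj a b) (ha : IsPendant (attachPendants G S s) a) :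
    ¬ IsPendant (attachPendants G S s) b := by
  have hmem : ∀ u ∈ S, ¬ IsPendant (attachPendants G S s) (Sum.inl u) := fun u hu =>
    not_isPendant_attachPendants_inl hu (hS u hu).choose_spec hs
  rcases a with u | p <;> rcases b with w | q
  · intro hb
    have hu : u ∉ S := fun h => hmem u h ha
    have hw : w ∉ S := fun h => hmem w h hb
    exact hG u w (attachPendants_adj_inl_inl.mp hab) ((isPendant_attachPendants_inl hu).mp ha)
      ((isPendant_attachPendants_inl hw).mp hb)
  · rw [attachPendants_adj_inl_inr] at hab
    exact absurd ha (hmem u (hab ▸ q.1.2))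
  · rw [attachPendants_adj_inr_inl] at hab
    exact hmem w (hab ▸ p.1.2)
  · exact absurd hab not_attachPendants_adj_inr_inr

theorem pendantCount_add_le_attachPendants_singleton (v : V) (s : ℕ) :
    pendantCount G + s ≤ pendantCount (attachPendants G {v} s) + 1 := by
  set P := Finset.univ.filter fun u => IsPendant G u with hP
  have hsub : (P.erase v).disjSum (Finset.univ : Finset (({v} : Finset V) × Fin s)) ⊆
      Finset.univ.filter fun a => IsPendant (attachPendants G {v} s) a := by
    rintro (u | p) h
    · simp only [Finset.inl_mem_disjSum, Finset.mem_erase, hP, Finset.mem_filter,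
        Finset.mem_univ, true_and] at h
      simpa using (isPendant_attachPendants_inl (by simpa using h.1)).mpr h.2
    · simpa using isPendant_attachPendants_inr p
  have hle := Finset.card_le_card hsub
  have herase := Finset.pred_card_le_card_erase (s := P) (a := v)
  rw [Finset.card_disjSum, Finset.card_univ, Fintype.card_prod, Fintype.card_coe,
    Finset.card_singleton, one_mul, Fintype.card_fin] at hle
  rw [pendantCount, pendantCount, ← hP]
  omega

end Pendants

/-- The labeling of `attachPendants G S s` that extends `f` by giving the `k`-th pendant edge
(counted from `0`) at a vertex of `S` the label `m + 1 + k`. -/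
def extendLabel (f : Sym2 V → ℕ) (m : ℕ) : Sym2 (V ⊕ (S × Fin s)) → ℕ :=
  Sym2.lift ⟨fun
    | Sum.inl u, Sum.inl w => f s(u, w)
    | Sum.inl _, Sum.inr p => m + 1 + p.2
    | Sum.inr p, Sum.inl _ => m + 1 + p.2
    | Sum.inr _, Sum.inr _ => 0, by rintro (_ | _) (_ | _) <;> simp [Sym2.eq_swap]⟩

@[simp]
theorem extendLabel_inl_inl (f : Sym2 V → ℕ) (m : ℕ) (u w : V) :
    extendLabel f m (s(Sum.inl u, Sum.inl w) : Sym2 (V ⊕ (S × Fin s))) = f s(u, w) := rfl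

@[simp]
theorem extendLabel_inl_inr (f : Sym2 V → ℕ) (m : ℕ) (u : V) (p : S × Fin s) :
    extendLabel f m s(Sum.inl u, Sum.inr p) = m + 1 + p.2 := rfl

@[simp]
theorem extendLabel_inr_inl (f : Sym2 V → ℕ) (m : ℕ) (u : V) (p : S × Fin s) :
    extendLabel f m s(Sum.inr p, Sum.inl u) = m + 1 + p.2 := rfl

theorem bijOn_extendLabel_singleton {f : Sym2 V → ℕ} {m : ℕ} (v : V)
    (hf : Set.BijOn f G.edgeSet (Set.Icc 1 m)) :
    Set.BijOn (extendLabel f m) (attachPendants G {v} s).edgeSet (Set.Icc 1 (m + s)) := by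
  have hcases : ∀ a ∈ (attachPendants G {v} s).edgeSet,
      (∃ b ∈ G.edgeSet, a = b.map Sum.inl) ∨
        ∃ k : Fin s, a = s(Sum.inl v, Sum.inr (⟨v, by simp⟩, k)) := by
    intro a ha
    induction a with
    | h x y =>
      rw [SimpleGraph.mem_edgeSet] at ha
      rcases x with u | ⟨⟨p, hp⟩, k⟩ <;> rcases y with w | ⟨⟨q, hq⟩, l⟩
      · exact Or.inl ⟨s(u, w), attachPendants_adj_inl_inl.mp ha, rfl⟩
      · obtain rfl := Finset.mem_singleton.mp hq
        obtain rfl := attachPendants_adj_inl_inr.mp ha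
        exact Or.inr ⟨l, rfl⟩
      · obtain rfl := Finset.mem_singleton.mp hp
        obtain rfl := attachPendants_adj_inr_inl.mp ha
        exact Or.inr ⟨k, Sym2.eq_swap⟩
      · exact absurd ha not_attachPendants_adj_inr_inr
  have hmap : ∀ b : Sym2 V,
      extendLabel f m (b.map Sum.inl : Sym2 (V ⊕ (({v} : Finset V) × Fin s))) = f b := by
    intro b
    induction b with
    | h x y => rfl
  refine ⟨?_, ?_, ?_⟩
  · intro a ha
    rcases hcases a ha with ⟨b, hb, rfl⟩ | ⟨k, rfl⟩
    · have := hf.mapsTo hb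
      rw [hmap]
      exact ⟨this.1, this.2.trans (Nat.le_add_right m s)⟩
    · simp only [extendLabel_inl_inr, Set.mem_Icc]
      omega
  · intro a ha a' ha' haa
    rcases hcases a ha with ⟨b, hb, rfl⟩ | ⟨k, rfl⟩ <;>
      rcases hcases a' ha' with ⟨b', hb', rfl⟩ | ⟨k', rfl⟩
    · rw [hmap, hmap] at haa
      rw [hf.injOn hb hb' haa]
    · have := (hf.mapsTo hb).2
      rw [hmap, extendLabel_inl_inr] at haa
      simp only at haa
      omega
    · have := (hf.mapsTo hb').2
      rw [hmap, extendLabel_inl_inr] at haa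
      simp only at haa
      omega
    · simp only [extendLabel_inl_inr] at haa
      rw [Fin.ext (show (k : ℕ) = k' by omega)]
  · intro n hn
    rw [Set.mem_Icc] at hn
    by_cases hnm : n ≤ m
    · obtain ⟨b, hb, rfl⟩ := hf.surjOn ⟨hn.1, hnm⟩
      refine ⟨b.map Sum.inl, ?_, hmap b⟩
      induction b with
      | h x y => exact attachPendants_adj_inl_inl.mpr hb
    · refine ⟨s(Sum.inl v, Sum.inr (⟨v, by simp⟩, ⟨n - m - 1, by omega⟩)), by simp, ?_⟩
      simp only [extendLabel_inl_inr]
      omega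

variable [Fintype V]

theorem vertexSum_extendLabel_inr (f : Sym2 V → ℕ) (m : ℕ) (p : S × Fin s) :
    vertexSum (attachPendants G S s) (extendLabel f m) (Sum.inr p) = m + 1 + p.2 := by
  refine vertexSum_eq_of_adj_unique (w := Sum.inl (p.1 : V)) _ (by simp) ?_
  rintro (u | q) h <;> simp_all

theorem vertexSum_extendLabel_inl (f : Sym2 V → ℕ) (m : ℕ) (u : V) :
    vertexSum (attachPendants G S s) (extendLabel f m) (Sum.inl u) =
      vertexSum G f u + ∑ p : S × Fin s, if u = p.1 then m + 1 + (p.2 : ℕ) else 0 := by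
  simp [vertexSum_eq_sum_ite]

theorem vertexSum_extendLabel_inl_of_notMem (f : Sym2 V → ℕ) (m : ℕ) {u : V} (hu : u ∉ S) :
    vertexSum (attachPendants G S s) (extendLabel f m) (Sum.inl u) = vertexSum G f u := by
  have hzero : ∀ p ∈ (Finset.univ : Finset (S × Fin s)),
      (if u = p.1 then m + 1 + (p.2 : ℕ) else 0) = 0 := by
    intro p _
    exact if_neg fun h : u = p.1 => hu (h ▸ p.1.2)
  rw [vertexSum_extendLabel_inl, Finset.sum_eq_zero hzero, add_zero]

theorem add_le_vertexSum_extendLabel_inl (f : Sym2 V → ℕ) (m : ℕ) {u : V} (hu : u ∈ S)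
    (hs : 1 ≤ s) : vertexSum G f u + (m + s) ≤
      vertexSum (attachPendants G S s) (extendLabel f m) (Sum.inl u) := by
  rw [vertexSum_extendLabel_inl]
  have := Finset.single_le_sum
    (f := fun p : S × Fin s => if u = p.1 then m + 1 + (p.2 : ℕ) else 0)
    (fun _ _ => Nat.zero_le _) (Finset.mem_univ (⟨u, hu⟩, ⟨s - 1, by omega⟩))
  simp only [if_true] at this
  omega

theorem card_edgeFinset_eq_of_bijOn {W : Type*} [Fintype W] {H : SimpleGraph W}
    {g : Sym2 W → ℕ} {m : ℕ} (hg : Set.BijOn g H.edgeSet (Set.Icc 1 m)) :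
    H.edgeFinset.card = m := by
  have := hg.ncard_eq
  rw [Set.ncard_eq_toFinset_card', Set.ncard_eq_toFinset_card'] at this
  simpa [SimpleGraph.edgeFinset] using this

/-- If every color of `f` is at most `m + s`, where `m` is the number of edges, then extending
`f` to the graph with `s` pendant edges attached at a non-isolated vertex `v` gives a local
antimagic labeling. -/
theorem IsLocalAntimagic.extendLabel_singleton {f : Sym2 V → ℕ} (hf : IsLocalAntimagic G f)
    {v w : V} (hvw : G.Adj v w) (hs : 1 ≤ s)
    (hle : ∀ u, vertexSum G f u ≤ G.edgeFinset.card + s) :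
    IsLocalAntimagic (attachPendants G {v} s) (extendLabel f G.edgeFinset.card) := by
  have hbij := bijOn_extendLabel_singleton (s := s) v hf.1
  refine ⟨by rwa [card_edgeFinset_eq_of_bijOn hbij], ?_⟩
  have hpos := (hf.label_mem hvw).1.trans (label_le_vertexSum f hvw)
  have hv := add_le_vertexSum_extendLabel_inl (G := G) f G.edgeFinset.card
    (Finset.mem_singleton_self v) hs
  have hother : ∀ u, u ≠ v → vertexSum (attachPendants G {v} s)
      (extendLabel f G.edgeFinset.card) (Sum.inl u) = vertexSum G f u := fun u hu =>
    vertexSum_extendLabel_inl_of_notMem f _ (by simpa using hu)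
  have hmixed : ∀ (u : V) (p : ({v} : Finset V) × Fin s), u = p.1 →
      vertexSum (attachPendants G {v} s) (extendLabel f G.edgeFinset.card) (Sum.inl u) ≠
      vertexSum (attachPendants G {v} s) (extendLabel f G.edgeFinset.card) (Sum.inr p) := by
    rintro u p rfl
    have := p.2.isLt
    rw [vertexSum_extendLabel_inr, Finset.mem_singleton.mp p.1.2]
    omega
  rintro (u | p) (x | q) hadj
  · rw [attachPendants_adj_inl_inl] at hadj
    by_cases hu : u = v
    · subst hu
      have := hle x
      rw [hother x hadj.ne']
      omega
    · by_cases hx : x = v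
      · subst hx
        have := hle u
        rw [hother u hu]
        omega
      · rw [hother u hu, hother x hx]
        exact hf.2 hadj
  · exact hmixed u q (attachPendants_adj_inl_inr.mp hadj)
  · exact (hmixed x p (attachPendants_adj_inr_inl.mp hadj)).symm
  · exact absurd hadj not_attachPendants_adj_inr_inr

end AttachPendants

namespace StandardSetup

variable [Fintype V] {G : SimpleGraph V} {f : Sym2 V → ℕ} {t r : ℕ} {Vset : ℕ → Finset V}
  {c : ℕ → ℕ}

theorem mem_unique (h : StandardSetup G f t r Vset c) {k l : ℕ} (hk : k ∈ Finset.Icc 1 t)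
    (hl : l ∈ Finset.Icc 1 t) {u : V} (huk : u ∈ Vset k) (hul : u ∈ Vset l) : k = l := by
  by_contra hne
  exact h.color_injective k hk l hl hne
    ((h.color_on_class k hk u huk).symm.trans (h.color_on_class l hl u hul))

theorem color_mono (h : StandardSetup G f t r Vset c) {k l : ℕ} (hk : 1 ≤ k) (hkl : k ≤ l)
    (hl : l ≤ r) : c k ≤ c l := by
  rcases hkl.eq_or_lt with rfl | hlt
  · exact le_rfl
  · exact (h.c_strictMono_low k l hk hlt hl).le

theorem color_le_card_edges (h : StandardSetup G f t r Vset c) {k : ℕ}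
    (hk : k ∈ Finset.Icc (r + 1) t) : c k ≤ G.edgeFinset.card := by
  obtain ⟨v, hv, hVk⟩ := h.pendant_singleton k hk
  rw [Finset.mem_Icc] at hk
  rw [← h.color_on_class k (Finset.mem_Icc.mpr ⟨by omega, hk.2⟩) v (by simp [hVk])]
  exact h.antimagic.vertexSum_le_of_isPendant hv

theorem pendantsInLow_add_le_pendantCount (h : StandardSetup G f t r Vset c) :
    pendantsInLow G Vset r + (t - r) ≤ pendantCount G := by
  have hhigh : ((Finset.Icc (r + 1) t).biUnion Vset).card = t - r := by
    rw [Finset.card_biUnion]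
    · rw [Finset.sum_congr rfl fun k hk => ?_, Finset.sum_const, Nat.card_Icc, smul_eq_mul,
        mul_one, Nat.add_sub_add_right]
      obtain ⟨v, _, hVk⟩ := h.pendant_singleton k hk
      rw [hVk, Finset.card_singleton]
    · intro k hk l hl hkl
      rw [Finset.mem_coe, Finset.mem_Icc] at hk hl
      exact Finset.disjoint_left.mpr fun u huk hul => hkl
        (h.mem_unique (Finset.mem_Icc.mpr (by omega)) (Finset.mem_Icc.mpr (by omega)) huk hul)
  have hdisj : Disjoint (((Finset.Icc 1 r).biUnion Vset).filter fun v => IsPendant G v)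
      ((Finset.Icc (r + 1) t).biUnion Vset) := by
    refine Finset.disjoint_left.mpr fun u hlow hhi => ?_
    obtain ⟨k, hk, huk⟩ := Finset.mem_biUnion.mp (Finset.mem_filter.mp hlow).1
    obtain ⟨l, hl, hul⟩ := Finset.mem_biUnion.mp hhi
    have hrt := h.r_le_t
    rw [Finset.mem_Icc] at hk hl
    have := h.mem_unique (Finset.mem_Icc.mpr (by omega)) (Finset.mem_Icc.mpr (by omega)) huk hul
    omega
  rw [pendantsInLow, ← hhigh, ← Finset.card_union_of_disjoint hdisj, pendantCount]
  refine Finset.card_le_card (Finset.union_subset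
    (Finset.filter_subset_filter _ (Finset.subset_univ _)) fun u hu => ?_)
  obtain ⟨l, hl, hul⟩ := Finset.mem_biUnion.mp hu
  obtain ⟨v, hv, hVl⟩ := h.pendant_singleton l hl
  rw [hVl, Finset.mem_singleton] at hul
  simpa [hul] using hv

end StandardSetup

/-- Theorem 2.2(2), "moreover" part: in the standard setup with
`r < t`, `G` not isomorphic to the star `K_{1,e}` and `e + s ≥ c_r` with `s ≥ 1`, for
`r + 1 ≤ i ≤ t` (so `Vᵢ` is a singleton pendant class): if `c_{j-1} ≤ e < c_j` for
some `2 ≤ j ≤ r` and `b = j - 1`, then `χ_la(G(Vᵢ, s)) = s + t - r + j - 1`. -/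
theorem chiLA_attachPendants_singleton_eq [Fintype V] (G : SimpleGraph V)
    (f : Sym2 V → ℕ) (t r : ℕ) (Vset : ℕ → Finset V) (c : ℕ → ℕ)
    (setup : StandardSetup G f t r Vset c) (hrt : r < t)
    (e s i j : ℕ) (he : G.edgeFinset.card = e)
    (hb : pendantsInLow G Vset r = j - 1)
    (hstar : ¬ Nonempty (G ≃g completeBipartiteGraph (Fin 1) (Fin e)))
    (hs : 1 ≤ s) (hbig : c r ≤ e + s)
    (hi₁ : r + 1 ≤ i) (hi₂ : i ≤ t)
    (hj₁ : 2 ≤ j) (hj₂ : j ≤ r)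
    (hce₁ : c (j - 1) ≤ e) (hce₂ : e < c j) :
    chiLA (attachPendants G (Vset i) s) = s + (t - r) + (j - 1) := by
  subst he
  have hi : i ∈ Finset.Icc (r + 1) t := Finset.mem_Icc.mpr ⟨hi₁, hi₂⟩
  obtain ⟨v, hv, hVi⟩ := setup.pendant_singleton i hi
  obtain ⟨w, hvw, -⟩ := isPendant_iff.mp hv
  rw [hVi]
  have hcolor : ∀ u, ∃ k, 1 ≤ k ∧ k ≤ t ∧ u ∈ Vset k ∧ vertexSum G f u = c k := by
    intro u
    obtain ⟨k, hk, huk⟩ := setup.class_cover u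
    exact ⟨k, (Finset.mem_Icc.mp hk).1, (Finset.mem_Icc.mp hk).2, huk,
      setup.color_on_class k hk u huk⟩
  have hle : ∀ u, vertexSum G f u ≤ G.edgeFinset.card + s := by
    intro u
    obtain ⟨k, hk₁, hk₂, -, hu⟩ := hcolor u
    rw [hu]
    by_cases hkr : k ≤ r
    · exact (setup.color_mono hk₁ hkr le_rfl).trans hbig
    · exact (setup.color_le_card_edges (Finset.mem_Icc.mpr (by omega))).trans
        (Nat.le_add_right _ _)
  have hanti := setup.antimagic.extendLabel_singleton hvw hs hle
  have hlower : ∀ g, IsLocalAntimagic (attachPendants G {v} s) g →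
      s + (t - r) + (j - 1) ≤ colorCount (attachPendants G {v} s) g := by
    intro g hg
    have hcard := card_edgeFinset_eq_of_bijOn
      (bijOn_extendLabel_singleton (s := s) v setup.antimagic.1)
    have h₁ := pendantCount_add_one_le_colorCount hg
      (not_isPendant_of_attachPendants_adj
        (fun _ _ => not_isPendant_of_adj_of_isPendant setup.connected setup.two_le_card_edges)
        (by simpa using ⟨w, hvw⟩) hs) (by omega)
    have h₂ := pendantCount_add_le_attachPendants_singleton (G := G) v s
    have h₃ := setup.pendantsInLow_add_le_pendantCount
    omega
  have hupper : colorCount (attachPendants G {v} s) (extendLabel f G.edgeFinset.card) ≤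
      s + (t - r) + (j - 1) := by
    set x := vertexSum (attachPendants G {v} s) (extendLabel f G.edgeFinset.card) (Sum.inl v)
    have hsub : Finset.univ.image
        (vertexSum (attachPendants G {v} s) (extendLabel f G.edgeFinset.card)) ⊆
        insert x ((Finset.Icc 1 (j - 1)).image c ∪ ((Finset.Icc (r + 1) t).erase i).image c ∪
          Finset.Icc (G.edgeFinset.card + 1) (G.edgeFinset.card + s)) := by
      intro y hy
      obtain ⟨a, -, rfl⟩ := Finset.mem_image.mp hy
      simp only [Finset.mem_insert, Finset.mem_union, or_assoc]
      rcases a with u | p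
      · by_cases huv : u = v
        · exact Or.inl (by rw [huv])
        · rw [vertexSum_extendLabel_inl_of_notMem f _ (by simpa using huv)]
          obtain ⟨k, hk₁, hk₂, huk, hu⟩ := hcolor u
          rw [hu]
          by_cases hkj : k ≤ j - 1
          · exact Or.inr (Or.inl (Finset.mem_image_of_mem c (Finset.mem_Icc.mpr ⟨hk₁, hkj⟩)))
          · by_cases hkr : k ≤ r
            · have h₁ := setup.color_mono (k := j) (l := k) (by omega) (by omega) hkr
              have h₂ := setup.color_mono hk₁ hkr le_rfl
              exact Or.inr (Or.inr (Or.inr (Finset.mem_Icc.mpr (by omega))))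
            · refine Or.inr (Or.inr (Or.inl (Finset.mem_image_of_mem c
                (Finset.mem_erase.mpr ⟨?_, Finset.mem_Icc.mpr (by omega)⟩))))
              rintro rfl
              rw [hVi] at huk
              exact huv (Finset.mem_singleton.mp huk)
      · have := p.2.isLt
        rw [vertexSum_extendLabel_inr]
        exact Or.inr (Or.inr (Or.inr (Finset.mem_Icc.mpr (by omega))))
    have h₁ := (Finset.card_le_card hsub).trans (Finset.card_insert_le _ _)
    have h₂ := Finset.card_union_le
      ((Finset.Icc 1 (j - 1)).image c ∪ ((Finset.Icc (r + 1) t).erase i).image c)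
      (Finset.Icc (G.edgeFinset.card + 1) (G.edgeFinset.card + s))
    have h₃ := Finset.card_union_le ((Finset.Icc 1 (j - 1)).image c)
      (((Finset.Icc (r + 1) t).erase i).image c)
    have h₄ := Finset.card_image_le (s := Finset.Icc 1 (j - 1)) (f := c)
    have h₅ := Finset.card_image_le (s := (Finset.Icc (r + 1) t).erase i) (f := c)
    rw [Finset.card_erase_of_mem hi] at h₅
    simp only [Nat.card_Icc] at h₂ h₄ h₅
    rw [colorCount]
    omega
  refine le_antisymm (le_trans (Nat.sInf_le ⟨_, hanti, rfl⟩) hupper) ?_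
  refine le_csInf ⟨_, ⟨_, hanti, rfl⟩⟩ ?_
  rintro _ ⟨g, hg, rfl⟩
  exact hlower g hg

end LocalAntimagic
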